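/- arXiv:1606.06618 — 8 statements merged into one kernel-verified Lean document; each statement's English description precedes it below -/
import Mathlib

section
/- Let N ≥ 2 be an even integer and let x_1 > x_2 > ... > x_N be a strictly decreasing solution of the Maxwell recursion with zero median, i.e., x_{N/2} + x_{N/2+1} = 0. Then: (P1) x_1 + ... + x_N = 0; (P2) x_1^2 + ... + x_N^2 = 3(N-1); (P3) x_n = -x_{N+1-n} for every n = 1,...,N. -/
open Finset

/-- A function on `{1, ..., N}` that is antisymmetric under `n ↦ N + 1 - n` sums to zero. -/
theorem sum_Icc_eq_zero_of_antisymm (N : ℕ) (f : ℕ → ℝ)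
    (h : ∀ n ∈ Finset.Icc 1 N, f n = -f (N + 1 - n)) : ∑ n ∈ Finset.Icc 1 N, f n = 0 := by
  have hrefl : ∑ n ∈ Finset.Icc 1 N, f (N + 1 - n) = ∑ n ∈ Finset.Icc 1 N, f n := by
    refine Finset.sum_nbij' (fun n => N + 1 - n) (fun n => N + 1 - n) ?_ ?_ ?_ ?_ ?_ <;>
      intro n hn <;> simp only [Finset.mem_Icc] at * <;> omega
  have hneg := Finset.sum_congr rfl h
  rw [Finset.sum_neg_distrib, hrefl] at hneg
  linarith

/-- A solution of the Maxwell recursion of length `2 * M` with zero median is antisymmetric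
about the median, and its sums of reciprocals are symmetric. -/
theorem maxwell_antisymm (M : ℕ) (x : ℕ → ℝ)
    (hrec : ∀ n ∈ Finset.Icc 1 (M + M - 1),
      (x (n + 1)) ^ 3 = (x n) ^ 3 - 3 / (∑ i ∈ Finset.Icc 1 n, (x i)⁻¹))
    (hmed : x M + x (M + 1) = 0) (k : ℕ) (hk : k < M) :
    x (M + 1 + k) = -x (M - k) ∧
      ∑ i ∈ Finset.Icc 1 (M + k), (x i)⁻¹ = ∑ i ∈ Finset.Icc 1 (M - k), (x i)⁻¹ := by
  induction k with
  | zero => exact ⟨by simpa using by linarith, rfl⟩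
  | succ k ih =>
    obtain ⟨hx, hsum⟩ := ih (by omega)
    obtain ⟨j, rfl⟩ : ∃ j, M = j + 1 + k := ⟨M - k - 1, by omega⟩
    rw [show j + 1 + k - k = j + 1 by omega] at hx hsum
    rw [show j + 1 + k - (k + 1) = j by omega]
    rw [show j + 1 + k + 1 + k = j + 1 + k + k + 1 by omega] at hx
    have hS : ∑ i ∈ Finset.Icc 1 (j + 1 + k + k + 1), (x i)⁻¹ = ∑ i ∈ Finset.Icc 1 j, (x i)⁻¹ := by
      rw [Finset.sum_Icc_succ_top (by omega), hsum, Finset.sum_Icc_succ_top (by omega), hx, inv_neg]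
      ring
    refine ⟨?_, hS⟩
    have hright := hrec (j + 1 + k + k + 1) (by simp only [Finset.mem_Icc]; omega)
    have hleft := hrec j (by simp only [Finset.mem_Icc]; omega)
    rw [hS, hx] at hright
    rw [show j + 1 + k + 1 + (k + 1) = j + 1 + k + k + 1 + 1 by omega]
    apply (Odd.strictMono_pow (R := ℝ) (n := 3) (by decide)).injective
    show x _ ^ 3 = (-x j) ^ 3
    rw [hright]
    linear_combination -hleft

/-- Summation by parts for the Maxwell recursion. -/
theorem maxwell_sum_sq (K : ℕ) (x : ℕ → ℝ)
    (hx0 : ∀ n ∈ Finset.Icc 1 K, x n ≠ 0)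
    (hS : ∀ n ∈ Finset.Icc 1 K, (∑ i ∈ Finset.Icc 1 n, (x i)⁻¹) ≠ 0)
    (hrec : ∀ n ∈ Finset.Icc 1 K,
      (x (n + 1)) ^ 3 = (x n) ^ 3 - 3 / (∑ i ∈ Finset.Icc 1 n, (x i)⁻¹)) :
    ∑ i ∈ Finset.Icc 1 K, (x i) ^ 2 =
      3 * (K : ℝ) + (∑ i ∈ Finset.Icc 1 K, (x i)⁻¹) * (x (K + 1)) ^ 3 := by
  induction K with
  | zero => simp
  | succ K ih =>
    have hsub : Finset.Icc 1 K ⊆ Finset.Icc 1 (K + 1) := Finset.Icc_subset_Icc_right (by omega)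
    have hmem : K + 1 ∈ Finset.Icc 1 (K + 1) := by simp
    have hsum := hS _ hmem
    have hx := hx0 _ hmem
    rw [hrec _ hmem, mul_sub, mul_div_cancel₀ _ hsum, Finset.sum_Icc_succ_top (by omega),
      Finset.sum_Icc_succ_top (by omega), ih (fun n hn => hx0 n (hsub hn))
        (fun n hn => hS n (hsub hn)) (fun n hn => hrec n (hsub hn))]
    push_cast
    field_simp
    ring

/-- Let `N ≥ 2` be even and `x 1 > x 2 > ... > x N` a strictly decreasing
solution of the Maxwell recursion `x (n+1) ^ 3 = x n ^ 3 - 3 / (∑_{i=1}^n (x i)⁻¹)`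
with zero median `x (N/2) + x (N/2+1) = 0`.  Then (P1) the sum vanishes,
(P2) the sum of squares equals `3 (N - 1)`, (P3) `x n = - x (N+1-n)` for all `n`. -/
theorem stmt0 (N : ℕ) (hN : Even N) (hN2 : 2 ≤ N) (x : ℕ → ℝ)
    (hx0 : ∀ n ∈ Finset.Icc 1 N, x n ≠ 0)
    (hS : ∀ n ∈ Finset.Icc 1 (N - 1), (∑ i ∈ Finset.Icc 1 n, (x i)⁻¹) ≠ 0)
    (hrec : ∀ n ∈ Finset.Icc 1 (N - 1),
      (x (n + 1)) ^ 3 = (x n) ^ 3 - 3 / (∑ i ∈ Finset.Icc 1 n, (x i)⁻¹))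
    (hdec : ∀ m ∈ Finset.Icc 1 N, ∀ n ∈ Finset.Icc 1 N, m < n → x n < x m)
    (hmed : x (N / 2) + x (N / 2 + 1) = 0) :
    (∑ n ∈ Finset.Icc 1 N, x n) = 0 ∧
    (∑ n ∈ Finset.Icc 1 N, (x n) ^ 2) = 3 * ((N : ℝ) - 1) ∧
    (∀ n ∈ Finset.Icc 1 N, x n = - x (N + 1 - n)) := by
  obtain ⟨M, rfl⟩ := hN
  rw [show (M + M) / 2 = M by omega] at hmed
  have hanti : ∀ n ∈ Finset.Icc 1 (M + M), x n = -x (M + M + 1 - n) := by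
    intro n hn
    rw [Finset.mem_Icc] at hn
    rcases le_or_gt n M with h | h
    · have hx := (maxwell_antisymm M x hrec hmed (M - n) (by omega)).1
      rw [show M + 1 + (M - n) = M + M + 1 - n by omega, show M - (M - n) = n by omega] at hx
      linarith
    · have hx := (maxwell_antisymm M x hrec hmed (n - (M + 1)) (by omega)).1
      rwa [show M + 1 + (n - (M + 1)) = n by omega,
        show M - (n - (M + 1)) = M + M + 1 - n by omega] at hx
  refine ⟨sum_Icc_eq_zero_of_antisymm _ x hanti, ?_, hanti⟩
  have hinv : ∑ n ∈ Finset.Icc 1 (M + M), (x n)⁻¹ = 0 :=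
    sum_Icc_eq_zero_of_antisymm _ (fun n => (x n)⁻¹) fun n hn => by
      rw [← inv_neg, ← hanti n hn]
  obtain ⟨K, hK⟩ : ∃ K, M + M = K + 1 := ⟨M + M - 1, by omega⟩
  have hcast : ((M + M : ℕ) : ℝ) = K + 1 := by exact_mod_cast hK
  rw [hcast]
  rw [hK] at hx0 hS hrec hinv ⊢
  rw [Nat.add_sub_cancel] at hS hrec
  have hsq := maxwell_sum_sq K x
    (fun n hn => hx0 n (Finset.Icc_subset_Icc_right (by omega) hn)) hS hrec
  have hlast := hx0 (K + 1) (by simp)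
  rw [Finset.sum_Icc_succ_top (by omega)] at hinv ⊢
  rw [hsq, eq_neg_of_add_eq_zero_left hinv]
  field_simp
  ring
end

section
/- Let N ≥ 2 and let x_1 > x_2 > ... > x_N be any strictly decreasing sequence of real numbers. Then U_1(x) · V(x) ≥ 9(N-1)^2. -/
open Finset

/-- Summation by parts: the weighted increments of `A` telescope when
`A n * (y n - y (n - 1)) = 1`. -/
theorem sum_Icc_sub_mul_of_mul_sub_eq_one {N : ℕ} {A y : ℕ → ℝ} (hA1 : A 1 = 0)
    (hA : ∀ n, 1 ≤ n → n + 1 ≤ N → A (n + 1) * (y (n + 1) - y n) = 1)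
    {k : ℕ} (hk : 1 ≤ k) (hkN : k ≤ N) :
    ∑ n ∈ Finset.Icc 1 k, (A (n + 1) - A n) * y n = A (k + 1) * y k - ((k : ℝ) - 1) := by
  induction k, hk using Nat.le_induction with
  | base => simp [hA1]
  | succ k hk ih =>
    rw [Finset.sum_Icc_succ_top (by lia), ih (by lia)]
    push_cast
    linear_combination -hA k hk hkN

/-- For any strictly decreasing `x 1 > ... > x N` (`N ≥ 2`), with
`A n = 1/(x n ^ 3 - x (n-1) ^ 3)` for `2 ≤ n ≤ N` and `A 1 = A (N+1) = 0`,
the interworld potential `U₁ = 9 ∑_{n=1}^N (A (n+1) - A n)² (x n)⁴` and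
potential energy `V = ∑_{n=1}^N (x n)²` satisfy `U₁ · V ≥ 9 (N-1)²`. -/
theorem stmt2 (N : ℕ) (hN : 2 ≤ N) (x : ℕ → ℝ)
    (hdec : ∀ m ∈ Finset.Icc 1 N, ∀ n ∈ Finset.Icc 1 N, m < n → x n < x m)
    (A : ℕ → ℝ)
    (hA : ∀ n, 2 ≤ n → n ≤ N → A n = ((x n) ^ 3 - (x (n - 1)) ^ 3)⁻¹)
    (hA1 : A 1 = 0) (hAN : A (N + 1) = 0) :
    (9 * ∑ n ∈ Finset.Icc 1 N, (A (n + 1) - A n) ^ 2 * (x n) ^ 4) *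
      (∑ n ∈ Finset.Icc 1 N, (x n) ^ 2) ≥ 9 * ((N : ℝ) - 1) ^ 2 := by
  have hmul : ∀ n, 1 ≤ n → n + 1 ≤ N → A (n + 1) * (x (n + 1) ^ 3 - x n ^ 3) = 1 := by
    intro n hn hnN
    have hlt : x (n + 1) < x n :=
      hdec n (Finset.mem_Icc.2 ⟨hn, by lia⟩) (n + 1) (Finset.mem_Icc.2 ⟨by lia, hnN⟩) (by lia)
    have hpow : x (n + 1) ^ 3 < x n ^ 3 := Odd.strictMono_pow (by decide) hlt
    rw [hA (n + 1) (by lia) hnN, Nat.add_sub_cancel]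
    exact inv_mul_cancel₀ (sub_neg.2 hpow).ne
  have hsum := sum_Icc_sub_mul_of_mul_sub_eq_one (y := fun n => x n ^ 3) hA1 hmul
    (by lia : 1 ≤ N) le_rfl
  have hcs := Finset.sum_mul_sq_le_sq_mul_sq (Finset.Icc 1 N)
    (fun n => (A (n + 1) - A n) * x n ^ 2) x
  have hprod : ∀ n, (A (n + 1) - A n) * x n ^ 2 * x n = (A (n + 1) - A n) * x n ^ 3 :=
    fun n => by ring
  have hsq : ∀ n, ((A (n + 1) - A n) * x n ^ 2) ^ 2 = (A (n + 1) - A n) ^ 2 * x n ^ 4 :=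
    fun n => by ring
  simp only [hprod, hsq, hsum, hAN] at hcs
  linarith
end

section
/- Let N ≥ 2 and let x_1 > x_2 > ... > x_N be any strictly decreasing sequence of real numbers. Then the Hamiltonian with zero momenta satisfies U_1(x) + V(x) ≥ 6(N-1). -/
open Finset

/-- Summation by parts for weights `A` with `A n * (y n - y (n - 1)) = 1` and `A 1 = 0`. -/
theorem sum_Icc_sub_mul_eq (N : ℕ) (y A : ℕ → ℝ) (hA1 : A 1 = 0)
    (h : ∀ n, 2 ≤ n → n ≤ N → A n * (y n - y (n - 1)) = 1) (k : ℕ) (hk : 1 ≤ k) (hkN : k ≤ N) :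
    ∑ n ∈ Finset.Icc 1 k, (A (n + 1) - A n) * y n = A (k + 1) * y k - ((k : ℝ) - 1) := by
  induction k, hk using Nat.le_induction with
  | base => simp [hA1]
  | succ k hk ih =>
    have hstep := h (k + 1) (by omega) hkN
    rw [Nat.add_sub_cancel] at hstep
    rw [Finset.sum_Icc_succ_top (by omega), ih (by omega)]
    push_cast
    linear_combination -hstep

/-- For any strictly decreasing `x 1 > ... > x N` (`N ≥ 2`), with
`A n = 1/(x n ^ 3 - x (n-1) ^ 3)` for `2 ≤ n ≤ N` and `A 1 = A (N+1) = 0`,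
the Hamiltonian with zero momenta satisfies `U₁ + V ≥ 6 (N-1)`. -/
theorem stmt3 (N : ℕ) (hN : 2 ≤ N) (x : ℕ → ℝ)
    (hdec : ∀ m ∈ Finset.Icc 1 N, ∀ n ∈ Finset.Icc 1 N, m < n → x n < x m)
    (A : ℕ → ℝ)
    (hA : ∀ n, 2 ≤ n → n ≤ N → A n = ((x n) ^ 3 - (x (n - 1)) ^ 3)⁻¹)
    (hA1 : A 1 = 0) (hAN : A (N + 1) = 0) :
    (9 * ∑ n ∈ Finset.Icc 1 N, (A (n + 1) - A n) ^ 2 * (x n) ^ 4) +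
      (∑ n ∈ Finset.Icc 1 N, (x n) ^ 2) ≥ 6 * ((N : ℝ) - 1) := by
  have hcube : ∀ n, 2 ≤ n → n ≤ N → A n * (x n ^ 3 - x (n - 1) ^ 3) = 1 := by
    intro n h2 hn
    have hlt : x n < x (n - 1) := hdec (n - 1) (Finset.mem_Icc.2 (by omega)) n
      (Finset.mem_Icc.2 (by omega)) (by omega)
    have hlt3 : x n ^ 3 < x (n - 1) ^ 3 := (show Odd 3 by decide).strictMono_pow hlt
    rw [hA n h2 hn]
    exact inv_mul_cancel₀ (sub_ne_zero.2 hlt3.ne)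
  have hsum := sum_Icc_sub_mul_eq N (fun n => x n ^ 3) A hA1 hcube N (by omega) le_rfl
  have hle : ∑ n ∈ Finset.Icc 1 N, -6 * ((A (n + 1) - A n) * x n ^ 3) ≤
      ∑ n ∈ Finset.Icc 1 N, (9 * ((A (n + 1) - A n) ^ 2 * x n ^ 4) + x n ^ 2) := by
    refine Finset.sum_le_sum fun n _ => ?_
    linarith [sq_nonneg (3 * (A (n + 1) - A n) * x n ^ 2 + x n)]
  rw [← Finset.mul_sum, hsum, hAN, Finset.sum_add_distrib, ← Finset.mul_sum] at hle
  linarith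
end

section
/- Let h : ℝ → ℝ be absolutely continuous with |h'(t)| ≤ c for all t, where c < ∞, and let Z be a standard normal random variable. Then for every y ∈ ℝ: h(y) - E[Z² h(Z)] = ∫_{-∞}^y h'(t) Φ(t) dt - ∫_y^∞ h'(t) (1 - Φ(t)) dt - E[Z h'(Z)], where Φ is the standard normal cumulative distribution function. -/
open MeasureTheory Set

/-- The standard normal density. -/
noncomputable def gaussPdf (x : ℝ) : ℝ := Real.exp (-x ^ 2 / 2) / Real.sqrt (2 * Real.pi)

/-- The standard normal cumulative distribution function `Φ`. -/
noncomputable def gaussCdf (t : ℝ) : ℝ := ∫ s in Set.Iic t, gaussPdf s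

lemma integrable_uIoc_indicator_mul {c y : ℝ} {f g : ℝ → ℝ} (hf : Measurable f)
    (hfc : ∀ t, |f t| ≤ c) (hg : Integrable g) (hg' : Integrable fun z => z * g z) :
    Integrable (fun p : ℝ × ℝ => (uIoc y p.1).indicator (fun t => f t * g p.1) p.2)
      ((volume : Measure ℝ).prod (volume : Measure ℝ)) := by
  have hset : MeasurableSet {p : ℝ × ℝ | p.2 ∈ uIoc y p.1} := by
    simp only [uIoc, mem_Ioc]
    exact (measurableSet_lt (measurable_const.min measurable_fst) measurable_snd).inter
      (measurableSet_le measurable_snd (measurable_const.max measurable_fst))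
  have hmeas : ∀ {u : ℝ → ℝ}, Measurable u → AEStronglyMeasurable
      (fun p : ℝ × ℝ => (uIoc y p.1).indicator (fun t => u t * g p.1) p.2)
      ((volume : Measure ℝ).prod (volume : Measure ℝ)) := fun {u} hu =>
    (((hu.comp measurable_snd).aestronglyMeasurable (μ := (volume : Measure ℝ).prod (volume : Measure ℝ))).mul
      (hg.aestronglyMeasurable.comp_fst)).indicator hset
  suffices hdom : Integrable (fun p : ℝ × ℝ => (uIoc y p.1).indicator (fun _ => c * g p.1) p.2)
      ((volume : Measure ℝ).prod (volume : Measure ℝ)) by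
    refine hdom.mono (hmeas hf) (.of_forall fun p => ?_)
    by_cases hp : p.2 ∈ uIoc y p.1
    · simp only [indicator_of_mem hp, norm_mul]
      gcongr
      exact (hfc _).trans (le_abs_self c)
    · simp [indicator_of_notMem hp]
  refine (integrable_prod_iff (hmeas measurable_const)).2 ⟨.of_forall fun z => ?_, ?_⟩
  · exact (integrable_indicator_iff measurableSet_uIoc).2
      (integrableOn_const (C := c * g z) (by simp [uIoc]))
  · have hint : Integrable fun z => |c| * ‖z * g z - y * g z‖ :=
      ((hg'.sub (hg.const_mul y)).norm).const_mul |c|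
    refine hint.congr (.of_forall fun z => ?_)
    simp only [norm_indicator_eq_indicator_norm]
    rw [integral_indicator measurableSet_uIoc, setIntegral_const, ← sub_mul]
    simp only [uIoc, measureReal_def, Real.volume_Ioc, norm_mul, Real.norm_eq_abs, smul_eq_mul,
      max_sub_min_eq_abs, ENNReal.toReal_ofReal (abs_nonneg _)]
    ring

/-- Fubini's theorem for a density weighted by the increments of an absolutely continuous
function with bounded derivative. -/
lemma integrable_and_integral_increment_mul {c : ℝ} {h f g : ℝ → ℝ} (hf : Measurable f)
    (hfc : ∀ t, |f t| ≤ c) (hh : ∀ y, h y = h 0 + ∫ t in (0:ℝ)..y, f t)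
    (hg : Integrable g) (hg' : Integrable fun z => z * g z) (y : ℝ) :
    Integrable (fun z => (h z - h y) * g z) ∧
    IntegrableOn (fun t => f t * ∫ z in Iic t, g z) (Iic y) ∧
    IntegrableOn (fun t => f t * ∫ z in Ioi t, g z) (Ioi y) ∧
    ∫ z, (h z - h y) * g z =
      (∫ t in Ioi y, f t * ∫ z in Ioi t, g z) - ∫ t in Iic y, f t * ∫ z in Iic t, g z := by
  have hloc : ∀ a b, IntervalIntegrable f volume a b := fun a b =>
    (intervalIntegrable_const (c := c)).mono_fun hf.aestronglyMeasurable
      (.of_forall fun t => (hfc t).trans (le_abs_self c))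
  let F : ℝ × ℝ → ℝ := fun p =>
    (if y < p.1 then 1 else -1) * (uIoc y p.1).indicator (fun t => f t * g p.1) p.2
  have hF : Integrable F ((volume : Measure ℝ).prod (volume : Measure ℝ)) := by
    refine (integrable_uIoc_indicator_mul hf hfc hg hg').bdd_mul (c := 1) ?_ (.of_forall ?_)
    · exact (Measurable.ite (measurableSet_lt (by fun_prop) (by fun_prop))
        measurable_const measurable_const).aestronglyMeasurable
    · intro p
      split_ifs <;> simp
  have hleft : ∀ z, ∫ t, F (z, t) = (h z - h y) * g z := by
    intro z
    have hsub : h z - h y = ∫ t in y..z, f t := by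
      rw [hh z, hh y, ← intervalIntegral.integral_interval_sub_left (hloc 0 z) (hloc 0 y)]
      ring
    simp only [F]
    rw [MeasureTheory.integral_const_mul (if y < z then (1 : ℝ) else -1),
      integral_indicator measurableSet_uIoc, integral_mul_const, hsub]
    split_ifs with hz
    · rw [intervalIntegral.integral_of_le hz.le, uIoc_of_le hz.le, one_mul]
    · rw [intervalIntegral.integral_of_ge (not_lt.1 hz), uIoc_of_ge (not_lt.1 hz)]
      ring
  have hright_Ioi : ∀ t ∈ Ioi y, ∫ z, F (z, t) = f t * ∫ z in Ioi t, g z := by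
    intro t ht
    rw [← integral_Ici_eq_integral_Ioi, ← integral_const_mul, ← integral_indicator measurableSet_Ici]
    congr 1 with z
    have ht' : y < t := ht
    simp only [F, indicator, uIoc, mem_Ioc, mem_Ici]
    grind
  have hright_Iic : ∀ t ∈ Iic y, ∫ z, F (z, t) = -(f t * ∫ z in Iic t, g z) := by
    intro t ht
    rw [integral_Iic_eq_integral_Iio, ← integral_const_mul, ← integral_indicator measurableSet_Iio,
      ← integral_neg]
    congr 1 with z
    have ht' : t ≤ y := ht
    simp only [F, indicator, uIoc, mem_Ioc, mem_Iio]
    grind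
  have hR := hF.integral_prod_right
  refine ⟨hF.integral_prod_left.congr (.of_forall hleft), ?_, ?_, ?_⟩
  · refine (hR.integrableOn.neg.congr_fun (fun t ht => ?_) measurableSet_Iic)
    simp only [Pi.neg_apply]
    rw [hright_Iic t ht, neg_neg]
  · exact hR.integrableOn.congr_fun hright_Ioi measurableSet_Ioi
  · calc ∫ z, (h z - h y) * g z = ∫ z, ∫ t, F (z, t) := by simp only [hleft]
      _ = ∫ t, ∫ z, F (z, t) := integral_integral_swap hF
      _ = (∫ t in Iic y, ∫ z, F (z, t)) + ∫ t in Ioi y, ∫ z, F (z, t) :=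
        (intervalIntegral.integral_Iic_add_Ioi hR.integrableOn hR.integrableOn).symm
      _ = _ := by
        rw [setIntegral_congr_fun measurableSet_Iic hright_Iic,
          setIntegral_congr_fun measurableSet_Ioi hright_Ioi, integral_neg]
        ring

lemma integrable_pow_mul_gaussPdf (n : ℕ) : Integrable fun z => z ^ n * gaussPdf z := by
  have hn : (-1 : ℝ) < n := by linarith [n.cast_nonneg (α := ℝ)]
  refine ((integrable_rpow_mul_exp_neg_mul_sq (b := 1 / 2) (by norm_num) hn).div_const
    (Real.sqrt (2 * Real.pi))).congr (.of_forall fun z => ?_)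
  simp only [gaussPdf, Real.rpow_natCast]
  ring_nf

lemma integrable_gaussPdf : Integrable gaussPdf := by
  simpa using integrable_pow_mul_gaussPdf 0

lemma integral_gaussPdf : ∫ z, gaussPdf z = 1 := by
  have hgauss := integral_gaussian (1 / 2)
  have hpi : Real.pi / (1 / 2) = 2 * Real.pi := by ring
  simp only [gaussPdf, integral_div]
  rw [hpi] at hgauss
  rw [div_eq_one_iff_eq (by positivity), ← hgauss]
  congr 1 with z
  ring_nf

lemma hasDerivAt_mul_gaussPdf (z : ℝ) :
    HasDerivAt (fun x => x * gaussPdf x) (gaussPdf z - z ^ 2 * gaussPdf z) z := by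
  have hexp : HasDerivAt (fun x : ℝ => -x ^ 2 / 2) (-z) z := by
    refine ((hasDerivAt_pow 2 z).fun_neg.div_const 2).congr_deriv ?_
    norm_num
    ring
  refine ((hasDerivAt_id' z).fun_mul
    (hexp.exp.div_const (Real.sqrt (2 * Real.pi)))).congr_deriv ?_
  simp only [gaussPdf]
  ring

lemma integrable_mul_gaussPdf : Integrable fun z => z * gaussPdf z := by
  simpa using integrable_pow_mul_gaussPdf 1

lemma integral_Iic_sq_mul_gaussPdf (t : ℝ) :
    ∫ z in Iic t, z ^ 2 * gaussPdf z = gaussCdf t - t * gaussPdf t := by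
  have hderiv := integrable_gaussPdf.sub (integrable_pow_mul_gaussPdf 2)
  have hlim := tendsto_zero_of_hasDerivAt_of_integrableOn_Iic (a := t)
    (fun z _ => hasDerivAt_mul_gaussPdf z) hderiv.integrableOn
    integrable_mul_gaussPdf.integrableOn
  have hftc := integral_Iic_of_hasDerivAt_of_tendsto' (a := t)
    (fun z _ => hasDerivAt_mul_gaussPdf z) hderiv.integrableOn hlim
  rw [integral_sub integrable_gaussPdf.integrableOn
    (integrable_pow_mul_gaussPdf 2).integrableOn] at hftc
  rw [gaussCdf]
  linarith

lemma integral_Ioi_gaussPdf (t : ℝ) : ∫ z in Ioi t, gaussPdf z = 1 - gaussCdf t := by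
  rw [gaussCdf, ← integral_gaussPdf, ← intervalIntegral.integral_Iic_add_Ioi (b := t)
    integrable_gaussPdf.integrableOn integrable_gaussPdf.integrableOn]
  ring

lemma integral_Ioi_sq_mul_gaussPdf (t : ℝ) :
    ∫ z in Ioi t, z ^ 2 * gaussPdf z = 1 - gaussCdf t + t * gaussPdf t := by
  have hderiv := integrable_gaussPdf.sub (integrable_pow_mul_gaussPdf 2)
  have hlim := tendsto_zero_of_hasDerivAt_of_integrableOn_Ioi (a := t)
    (fun z _ => hasDerivAt_mul_gaussPdf z) hderiv.integrableOn
    integrable_mul_gaussPdf.integrableOn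
  have hftc := integral_Ioi_of_hasDerivAt_of_tendsto' (a := t)
    (fun z _ => hasDerivAt_mul_gaussPdf z) hderiv.integrableOn hlim
  rw [integral_sub integrable_gaussPdf.integrableOn
    (integrable_pow_mul_gaussPdf 2).integrableOn, integral_Ioi_gaussPdf] at hftc
  linarith

lemma integral_sq_mul_gaussPdf : ∫ z, z ^ 2 * gaussPdf z = 1 := by
  have hint := integrable_pow_mul_gaussPdf 2
  rw [← intervalIntegral.integral_Iic_add_Ioi (b := 0) hint.integrableOn hint.integrableOn,
    integral_Iic_sq_mul_gaussPdf, integral_Ioi_sq_mul_gaussPdf]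
  ring

/-- If `h` is absolutely continuous with a.e. derivative `h'` bounded by `c`,
then for every `y`,
`h y - E[Z² h Z] = ∫_{-∞}^y h' t Φ t dt - ∫_y^∞ h' t (1 - Φ t) dt - E[Z h' Z]`,
where `Z` is standard normal. -/
theorem stmt4 (c : ℝ) (h h' : ℝ → ℝ)
    (hmeas : Measurable h')
    (hbd : ∀ t, |h' t| ≤ c)
    (hac : ∀ y, h y = h 0 + ∫ t in (0:ℝ)..y, h' t)
    (y : ℝ) :
    h y - (∫ z, z ^ 2 * h z * gaussPdf z) =
      (∫ t in Set.Iic y, h' t * gaussCdf t)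
        - (∫ t in Set.Ioi y, h' t * (1 - gaussCdf t))
        - ∫ z, z * h' z * gaussPdf z := by
  have hsq := integrable_pow_mul_gaussPdf 2
  have hcube : Integrable fun z => z * (z ^ 2 * gaussPdf z) :=
    (integrable_pow_mul_gaussPdf 3).congr (.of_forall fun z => by ring)
  obtain ⟨hinc, hIic, hIoi, heq⟩ :=
    integrable_and_integral_increment_mul hmeas hbd hac hsq hcube y
  have hstein : Integrable fun z => z * h' z * gaussPdf z :=
    (integrable_mul_gaussPdf.bdd_mul hmeas.aestronglyMeasurable (.of_forall hbd)).congr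
      (.of_forall fun z => by ring)
  have hlhs : ∫ z, z ^ 2 * h z * gaussPdf z =
      (∫ z, (h z - h y) * (z ^ 2 * gaussPdf z)) + h y := by
    have hmean : ∫ z, h y * (z ^ 2 * gaussPdf z) = h y := by
      rw [integral_const_mul, integral_sq_mul_gaussPdf, mul_one]
    rw [← hmean, ← integral_add (by simpa only [hmean] using hinc) (hsq.const_mul _), hmean]
    congr 1 with z
    ring
  have hlower : ∫ t in Iic y, h' t * gaussCdf t =
      (∫ t in Iic y, h' t * ∫ z in Iic t, z ^ 2 * gaussPdf z) +
        ∫ t in Iic y, t * h' t * gaussPdf t := by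
    rw [← integral_add hIic hstein.integrableOn]
    congr 1 with t
    rw [integral_Iic_sq_mul_gaussPdf]
    ring
  have hupper : ∫ t in Ioi y, h' t * (1 - gaussCdf t) =
      (∫ t in Ioi y, h' t * ∫ z in Ioi t, z ^ 2 * gaussPdf z) -
        ∫ t in Ioi y, t * h' t * gaussPdf t := by
    rw [← integral_sub hIoi hstein.integrableOn]
    congr 1 with t
    rw [integral_Ioi_sq_mul_gaussPdf]
    ring
  have hsplit := intervalIntegral.integral_Iic_add_Ioi (b := y) hstein.integrableOn
    hstein.integrableOn
  rw [hlhs, heq, hlower, hupper, ← hsplit]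
  ring
end

section
/- Let N ≥ 2 be an even integer and let x_1 > x_2 > ... > x_N be a strictly decreasing solution of the Maxwell recursion with zero median, i.e., x_{N/2} + x_{N/2+1} = 0. Then the smallest positive value satisfies x_{N/2} ≥ √(3/N). -/
open Finset

/-- Let `N ≥ 2` be even and `x 1 > ... > x N` a strictly decreasing
solution of the Maxwell recursion with zero median.  Then the smallest positive
value satisfies `x (N/2) ≥ √(3/N)`. -/
theorem stmt14 (N : ℕ) (hN : Even N) (hN2 : 2 ≤ N) (x : ℕ → ℝ)
    (hx0 : ∀ n ∈ Finset.Icc 1 N, x n ≠ 0)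
    (hS : ∀ n ∈ Finset.Icc 1 (N - 1), (∑ i ∈ Finset.Icc 1 n, (x i)⁻¹) ≠ 0)
    (hrec : ∀ n ∈ Finset.Icc 1 (N - 1),
      (x (n + 1)) ^ 3 = (x n) ^ 3 - 3 / (∑ i ∈ Finset.Icc 1 n, (x i)⁻¹))
    (hdec : ∀ m ∈ Finset.Icc 1 N, ∀ n ∈ Finset.Icc 1 N, m < n → x n < x m)
    (hmed : x (N / 2) + x (N / 2 + 1) = 0) :
    Real.sqrt (3 / N) ≤ x (N / 2) := by
  obtain ⟨m, rfl⟩ := hN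
  have hm : 1 ≤ m := by lia
  rw [show (m + m) / 2 = m by lia] at *
  have hpos : 0 < x m := by
    have := hdec m (by simp; lia) (m + 1) (by simp; lia) (by lia)
    linarith
  have hmem : m ∈ Finset.Icc 1 (m + m - 1) := by simp; lia
  have hrec_m := hrec m hmem
  have hS_m := hS m hmem
  have hbound : ∑ i ∈ Finset.Icc 1 m, (x i)⁻¹ ≤ m * (x m)⁻¹ := by
    have h := Finset.sum_le_card_nsmul (Finset.Icc 1 m) (fun i ↦ (x i)⁻¹) (x m)⁻¹ ?_
    · simpa using h
    intro i hi
    rw [Finset.mem_Icc] at hi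
    have hle : x m ≤ x i := by
      rcases hi.2.eq_or_lt with rfl | hlt
      · rfl
      · exact (hdec i (by simp; lia) m (by simp; lia) hlt).le
    exact inv_anti₀ hpos hle
  generalize ∑ i ∈ Finset.Icc 1 m, (x i)⁻¹ = S at hrec_m hS_m hbound
  rw [show x (m + 1) = -x m by linarith] at hrec_m
  have hS_eq : 2 * x m ^ 3 * S = 3 := by
    field_simp at hrec_m
    linarith
  have hkey : 3 ≤ 2 * m * x m ^ 2 := by
    calc (3 : ℝ) = 2 * x m ^ 3 * S := hS_eq.symm
      _ ≤ 2 * x m ^ 3 * (m * (x m)⁻¹) := by gcongr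
      _ = 2 * m * x m ^ 2 := by field_simp
  have hm_pos : (0 : ℝ) < m := by exact_mod_cast hm
  refine Real.sqrt_le_iff.2 ⟨hpos.le, ?_⟩
  rw [div_le_iff₀ (by positivity)]
  push_cast
  linarith
end

section
/- Let h, c, μ, G, g be as in the context. Then |g(x)| ≤ 3c for every x ∈ ℝ, i.e., |G(x)| ≤ 3c(x²+2) for all x. -/
open MeasureTheory

lemma integrable_pow_mul_exp_neg_sq_div_two (n : ℕ) :
    Integrable fun y : ℝ => y ^ n * Real.exp (-y ^ 2 / 2) := by
  have h := integrable_rpow_mul_exp_neg_mul_sq (b := 1 / 2) (by norm_num) (s := (n : ℝ))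
    (by have : (0 : ℝ) ≤ n := n.cast_nonneg
        linarith)
  refine h.congr (Filter.Eventually.of_forall fun y => ?_)
  simp only [Real.rpow_natCast]
  congr 2
  ring

lemma hasDerivAt_exp_neg_sq_div_two (y : ℝ) :
    HasDerivAt (fun y : ℝ => Real.exp (-y ^ 2 / 2)) (-y * Real.exp (-y ^ 2 / 2)) y := by
  have h : HasDerivAt (fun y : ℝ => -y ^ 2 / 2) (-y) y := by
    refine ((hasDerivAt_pow 2 y).neg.div_const 2).congr_deriv ?_
    push_cast
    ring
  exact h.exp.congr_deriv (mul_comm _ _)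

lemma integral_sq_mul_exp_neg_sq_div_two :
    ∫ y : ℝ, y ^ 2 * Real.exp (-y ^ 2 / 2) = Real.sqrt (2 * Real.pi) := by
  have h0 := integrable_pow_mul_exp_neg_sq_div_two 0
  have h1 := integrable_pow_mul_exp_neg_sq_div_two 1
  have h2 := integrable_pow_mul_exp_neg_sq_div_two 2
  have hd (y : ℝ) : HasDerivAt (fun y : ℝ => y ^ 1 * Real.exp (-y ^ 2 / 2))
      (y ^ 0 * Real.exp (-y ^ 2 / 2) - y ^ 2 * Real.exp (-y ^ 2 / 2)) y := by
    refine ((hasDerivAt_pow 1 y).mul (hasDerivAt_exp_neg_sq_div_two y)).congr_deriv ?_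
    push_cast
    ring
  have hz := integral_eq_zero_of_hasDerivAt_of_integrable hd (h0.sub h2) h1
  rw [integral_sub h0 h2, sub_eq_zero] at hz
  rw [← hz]
  have hg := integral_gaussian (1 / 2)
  calc ∫ y : ℝ, y ^ 0 * Real.exp (-y ^ 2 / 2)
      = ∫ y : ℝ, Real.exp (-(1 / 2) * y ^ 2) := by
        congr 1
        ext y
        rw [pow_zero, one_mul]
        congr 1
        ring
    _ = Real.sqrt (2 * Real.pi) := by
        rw [hg]
        congr 1
        ring

lemma integrable_even_poly_mul_exp (a b : ℝ) :
    Integrable fun y : ℝ => (a * y ^ 2 + b) * Real.exp (-y ^ 2 / 2) := by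
  refine (((integrable_pow_mul_exp_neg_sq_div_two 2).const_mul a).add
    ((integrable_pow_mul_exp_neg_sq_div_two 0).const_mul b)).congr
    (Filter.Eventually.of_forall fun y => ?_)
  simp only [Pi.add_apply]
  ring

lemma integrable_odd_poly_mul_exp (a b : ℝ) :
    Integrable fun y : ℝ => (a * y ^ 3 + b * y) * Real.exp (-y ^ 2 / 2) := by
  refine (((integrable_pow_mul_exp_neg_sq_div_two 3).const_mul a).add
    ((integrable_pow_mul_exp_neg_sq_div_two 1).const_mul b)).congr
    (Filter.Eventually.of_forall fun y => ?_)
  simp only [Pi.add_apply]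
  ring

lemma hasDerivAt_even_poly_mul_exp (a b y : ℝ) :
    HasDerivAt (fun y : ℝ => (-a * y ^ 2 + -(2 * a + b)) * Real.exp (-y ^ 2 / 2))
      ((a * y ^ 3 + b * y) * Real.exp (-y ^ 2 / 2)) y := by
  refine ((((hasDerivAt_pow 2 y).const_mul (-a)).add_const (-(2 * a + b))).mul
    (hasDerivAt_exp_neg_sq_div_two y)).congr_deriv ?_
  push_cast
  ring

lemma integral_Ioi_odd_poly_mul_exp (a b x : ℝ) :
    ∫ y in Set.Ioi x, (a * y ^ 3 + b * y) * Real.exp (-y ^ 2 / 2) =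
      (a * x ^ 2 + (2 * a + b)) * Real.exp (-x ^ 2 / 2) := by
  have ht := tendsto_zero_of_hasDerivAt_of_integrableOn_Ioi (a := x)
    (fun y _ => hasDerivAt_even_poly_mul_exp a b y)
    (integrable_odd_poly_mul_exp a b).integrableOn
    (integrable_even_poly_mul_exp (-a) (-(2 * a + b))).integrableOn
  rw [integral_Ioi_of_hasDerivAt_of_tendsto' (fun y _ => hasDerivAt_even_poly_mul_exp a b y)
    (integrable_odd_poly_mul_exp a b).integrableOn ht]
  ring

lemma integral_Iic_odd_poly_mul_exp (a b x : ℝ) :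
    ∫ y in Set.Iic x, (a * y ^ 3 + b * y) * Real.exp (-y ^ 2 / 2) =
      -((a * x ^ 2 + (2 * a + b)) * Real.exp (-x ^ 2 / 2)) := by
  have ht := tendsto_zero_of_hasDerivAt_of_integrableOn_Iic (a := x)
    (fun y _ => hasDerivAt_even_poly_mul_exp a b y)
    (integrable_odd_poly_mul_exp a b).integrableOn
    (integrable_even_poly_mul_exp (-a) (-(2 * a + b))).integrableOn
  rw [integral_Iic_of_hasDerivAt_of_tendsto' (fun y _ => hasDerivAt_even_poly_mul_exp a b y)
    (integrable_odd_poly_mul_exp a b).integrableOn ht]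
  ring

lemma integrable_abs_mul_sq_mul_exp :
    Integrable fun y : ℝ => |y| * (y ^ 2 * Real.exp (-y ^ 2 / 2)) := by
  refine (integrable_pow_mul_exp_neg_sq_div_two 3).abs.congr
    (Filter.Eventually.of_forall fun y => ?_)
  simp only [abs_mul, abs_pow, Real.abs_exp]
  rw [← sq_abs y]
  ring

lemma integral_abs_mul_sq_mul_exp :
    ∫ y : ℝ, |y| * (y ^ 2 * Real.exp (-y ^ 2 / 2)) = 4 := by
  have h := integral_comp_abs (f := fun y : ℝ => (1 * y ^ 3 + 0 * y) * Real.exp (-y ^ 2 / 2))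
  rw [integral_Ioi_odd_poly_mul_exp] at h
  simp only [sq_abs] at h
  calc _ = ∫ y : ℝ, (1 * |y| ^ 3 + 0 * |y|) * Real.exp (-y ^ 2 / 2) := by
        congr 1
        ext y
        rw [← sq_abs y]
        ring
    _ = 4 := by
        rw [h]
        norm_num

lemma abs_sub_le_of_eq_add_integral {c : ℝ} {h h' : ℝ → ℝ} (hmeas : Measurable h')
    (hbd : ∀ t, |h' t| ≤ c) (hac : ∀ y, h y = h 0 + ∫ t in (0:ℝ)..y, h' t) (y z : ℝ) :
    |h y - h z| ≤ c * |y - z| := by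
  have hi (a b : ℝ) : IntervalIntegrable h' volume a b :=
    (intervalIntegrable_const (c := c)).mono_fun hmeas.aestronglyMeasurable
      (Filter.Eventually.of_forall fun t => (hbd t).trans (le_abs_self c))
  have he : h y - h z = ∫ t in z..y, h' t := by
    rw [hac y, hac z, ← intervalIntegral.integral_interval_sub_left (hi 0 y) (hi 0 z)]
    ring
  rw [he]
  rw [← Real.norm_eq_abs]
  exact intervalIntegral.norm_integral_le_of_norm_le_const fun t _ => hbd t

/-- With `h` absolutely continuous, `|h'| ≤ c`, `μh = E[h(X)]` for `X` with
density `x² φ(x)`, `G(x) = e^{x²/2} ∫_{-∞}^x y² (h y - μh) e^{-y²/2} dy` and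
`g(x) = G(x)/(x²+2)`, one has `|g x| ≤ 3c` for all `x`, i.e. `|G x| ≤ 3c (x²+2)`. -/
theorem stmt16 (c : ℝ) (h h' : ℝ → ℝ) (hmeas : Measurable h') (hbd : ∀ t, |h' t| ≤ c)
    (hac : ∀ y, h y = h 0 + ∫ t in (0:ℝ)..y, h' t)
    (μh : ℝ) (hμh : μh = ∫ y, h y * (y ^ 2 * gaussPdf y))
    (G : ℝ → ℝ)
    (hG : ∀ x, G x = Real.exp (x ^ 2 / 2) *
      ∫ y in Set.Iic x, y ^ 2 * (h y - μh) * Real.exp (-y ^ 2 / 2))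
    (g : ℝ → ℝ) (hg : ∀ x, g x = G x / (x ^ 2 + 2)) :
    (∀ x, |g x| ≤ 3 * c) ∧ (∀ x, |G x| ≤ 3 * c * (x ^ 2 + 2)) := by
  have hc : 0 ≤ c := (abs_nonneg _).trans (hbd 0)
  have hlip := abs_sub_le_of_eq_add_integral hmeas hbd hac
  have hcont : Continuous h :=
    (LipschitzWith.of_dist_le_mul (K := ⟨c, hc⟩) fun y z => hlip y z).continuous
  set w : ℝ → ℝ := fun y => y ^ 2 * Real.exp (-y ^ 2 / 2) with hw
  have hw0 (y : ℝ) : 0 ≤ w y := by positivity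
  have hwi : Integrable w := integrable_pow_mul_exp_neg_sq_div_two 2
  have hwc : Continuous w := by fun_prop
  set s := Real.sqrt (2 * Real.pi) with hs
  have hws : ∫ y, w y = s := integral_sq_mul_exp_neg_sq_div_two
  have hs2 : 2 ≤ s := Real.le_sqrt_of_sq_le (by linarith [Real.pi_gt_three])
  have hdb (y : ℝ) : ‖(h y - h 0) * w y‖ ≤ c * (|y| * w y) := by
    rw [Real.norm_eq_abs, abs_mul, abs_of_nonneg (hw0 y)]
    exact (mul_le_mul_of_nonneg_right (by simpa using hlip y 0) (hw0 y)).trans_eq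
      (mul_assoc c |y| (w y))
  have hdi : Integrable fun y => (h y - h 0) * w y := by
    refine (integrable_abs_mul_sq_mul_exp.const_mul c).mono'
      (by fun_prop) (Filter.Eventually.of_forall hdb)
  have hmean : (μh - h 0) * s = ∫ y, (h y - h 0) * w y := by
    have e1 : μh * s = ∫ y, h y * w y := by
      rw [hμh, ← integral_mul_const]
      congr 1
      ext y
      simp only [gaussPdf, hw, ← hs]
      field_simp
    have hhi : Integrable fun y => h y * w y := by
      refine (hdi.add (hwi.const_mul (h 0))).congr (Filter.Eventually.of_forall fun y => ?_)
      simp only [Pi.add_apply]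
      ring
    calc (μh - h 0) * s = (∫ y, h y * w y) - ∫ y, h 0 * w y := by
          rw [integral_const_mul, hws, ← e1]
          ring
      _ = _ := by
          rw [← integral_sub hhi (hwi.const_mul _)]
          congr 1
          ext y
          ring
  have hμ : |μh - h 0| ≤ 2 * c := by
    have h4 : |(μh - h 0) * s| ≤ c * 4 := by
      rw [hmean, ← integral_abs_mul_sq_mul_exp, ← integral_const_mul, ← Real.norm_eq_abs]
      exact norm_integral_le_of_norm_le (integrable_abs_mul_sq_mul_exp.const_mul c)
        (Filter.Eventually.of_forall hdb)
    rw [abs_mul, abs_of_nonneg (by linarith : 0 ≤ s)] at h4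
    nlinarith [abs_nonneg (μh - h 0)]
  set f : ℝ → ℝ := fun y => y ^ 2 * (h y - μh) * Real.exp (-y ^ 2 / 2) with hf
  have hfe : f = fun y => (h y - h 0) * w y - (μh - h 0) * w y := by
    ext y
    simp only [hf, hw]
    ring
  have hfi : Integrable f := by
    rw [hfe]
    exact hdi.sub (hwi.const_mul _)
  have hf0 : ∫ y, f y = 0 := by
    rw [hfe, integral_sub hdi (hwi.const_mul _), integral_const_mul, hws, hmean, sub_self]
  have hfb (y : ℝ) : |f y| ≤ (2 * c * |y| ^ 3 + c * |y|) * Real.exp (-y ^ 2 / 2) := by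
    simp only [hf]
    rw [abs_mul, Real.abs_exp, abs_mul, abs_pow]
    refine mul_le_mul_of_nonneg_right ?_ (Real.exp_pos _).le
    have h1 : |h y - μh| ≤ c * |y| + 2 * c := by
      have := abs_sub_le (h y) (h 0) μh
      have h2 := hlip y 0
      rw [sub_zero] at h2
      rw [abs_sub_comm (h 0)] at this
      linarith
    calc |y| ^ 2 * |h y - μh| ≤ |y| ^ 2 * (c * |y| + 2 * c) :=
          mul_le_mul_of_nonneg_left h1 (by positivity)
      _ ≤ _ := by
          have : 0 ≤ c * |y| * (|y| - 1) ^ 2 := by positivity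
          linarith
  have hint (x : ℝ) : |∫ y in Set.Iic x, f y| ≤
      3 * c * (x ^ 2 + 2) * Real.exp (-x ^ 2 / 2) := by
    have hle : (2 * c * x ^ 2 + (2 * (2 * c) + c)) * Real.exp (-x ^ 2 / 2) ≤
        3 * c * (x ^ 2 + 2) * Real.exp (-x ^ 2 / 2) := by
      refine mul_le_mul_of_nonneg_right ?_ (Real.exp_pos _).le
      nlinarith [mul_nonneg hc (sq_nonneg x)]
    refine le_trans ?_ hle
    rw [← Real.norm_eq_abs]
    rcases le_total x 0 with hx | hx
    · have hI := integral_Iic_odd_poly_mul_exp (-(2 * c)) (-c) x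
      refine le_trans (norm_integral_le_of_norm_le
        (integrable_odd_poly_mul_exp (-(2 * c)) (-c)).integrableOn ?_) (hI.trans (by ring)).le
      refine (ae_restrict_iff' measurableSet_Iic).2 (Filter.Eventually.of_forall fun y hy => ?_)
      have := hfb y
      rw [abs_of_nonpos (le_trans hy hx : y ≤ 0)] at this
      exact this.trans_eq (by ring)
    · have hsplit := intervalIntegral.integral_Iic_add_Ioi (b := x)
        hfi.integrableOn hfi.integrableOn
      rw [hf0] at hsplit
      rw [eq_neg_of_add_eq_zero_left hsplit, norm_neg]
      refine le_trans (norm_integral_le_of_norm_le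
        (integrable_odd_poly_mul_exp (2 * c) c).integrableOn ?_)
        (integral_Ioi_odd_poly_mul_exp (2 * c) c x).le
      refine (ae_restrict_iff' measurableSet_Ioi).2 (Filter.Eventually.of_forall fun y hy => ?_)
      have := hfb y
      rwa [abs_of_nonneg (hx.trans (le_of_lt hy) : 0 ≤ y)] at this
  have hGb (x : ℝ) : |G x| ≤ 3 * c * (x ^ 2 + 2) := by
    rw [hG, abs_mul, Real.abs_exp]
    calc _ ≤ Real.exp (x ^ 2 / 2) * (3 * c * (x ^ 2 + 2) * Real.exp (-x ^ 2 / 2)) :=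
          mul_le_mul_of_nonneg_left (hint x) (Real.exp_pos _).le
      _ = 3 * c * (x ^ 2 + 2) * Real.exp (x ^ 2 / 2 + -x ^ 2 / 2) := by
          rw [Real.exp_add]
          ring
      _ = _ := by
          rw [show x ^ 2 / 2 + -x ^ 2 / 2 = 0 by ring, Real.exp_zero, mul_one]
  refine ⟨fun x => ?_, hGb⟩
  have hpos : 0 < x ^ 2 + 2 := by positivity
  rw [hg, abs_div, abs_of_pos hpos, div_le_iff₀ hpos]
  exact hGb x
end

section
/- Let h, c, μ, G, g, χ be as in the context. Then for every x ≠ 0, |χ(x)| ≤ 6c and |χ'(x)| ≤ 7c. -/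
open MeasureTheory

namespace GaussianSteinBound

lemma integrable_pow_mul_gauss (n : ℕ) :
    Integrable fun y : ℝ => y ^ n * Real.exp (-y ^ 2 / 2) := by
  have h := integrable_rpow_mul_exp_neg_mul_sq (b := 1 / 2) (by norm_num) (s := (n : ℝ))
    (by have : (0 : ℝ) ≤ n := n.cast_nonneg
        linarith)
  refine h.congr (Filter.Eventually.of_forall fun y => ?_)
  simp only [Real.rpow_natCast]
  congr 2
  ring

lemma hasDerivAt_gauss (y : ℝ) :
    HasDerivAt (fun y : ℝ => Real.exp (-y ^ 2 / 2)) (-y * Real.exp (-y ^ 2 / 2)) y := by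
  have h : HasDerivAt (fun y : ℝ => -y ^ 2 / 2) (-y) y := by
    refine ((hasDerivAt_pow 2 y).neg.div_const 2).congr_deriv ?_
    norm_num
    ring
  exact h.exp.congr_deriv (mul_comm _ _)

lemma integral_gauss : ∫ y : ℝ, Real.exp (-y ^ 2 / 2) = Real.sqrt (2 * Real.pi) := by
  have h := integral_gaussian (1 / 2)
  rw [show Real.pi / (1 / 2) = 2 * Real.pi by ring] at h
  rw [← h]
  congr 1 with y
  congr 1
  ring

lemma integral_pow_add_two_mul_gauss (n : ℕ) :
    ∫ y : ℝ, y ^ (n + 2) * Real.exp (-y ^ 2 / 2)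
      = (n + 1) * ∫ y : ℝ, y ^ n * Real.exp (-y ^ 2 / 2) := by
  have hd : ∀ y : ℝ, HasDerivAt (fun y : ℝ => y ^ (n + 1) * Real.exp (-y ^ 2 / 2))
      ((n + 1) * (y ^ n * Real.exp (-y ^ 2 / 2)) - y ^ (n + 2) * Real.exp (-y ^ 2 / 2)) y := by
    intro y
    refine ((hasDerivAt_pow (n + 1) y).mul (hasDerivAt_gauss y)).congr_deriv ?_
    push_cast
    ring
  have hi := (integrable_pow_mul_gauss n).const_mul ((n : ℝ) + 1)
  have h := integral_eq_zero_of_hasDerivAt_of_integrable hd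
    (hi.sub (integrable_pow_mul_gauss (n + 2))) (integrable_pow_mul_gauss (n + 1))
  rw [integral_sub hi (integrable_pow_mul_gauss (n + 2)), integral_const_mul] at h
  linarith

lemma pow_mul_gaussPdf (n : ℕ) (y : ℝ) :
    y ^ n * gaussPdf y = y ^ n * Real.exp (-y ^ 2 / 2) / Real.sqrt (2 * Real.pi) := by
  rw [gaussPdf, mul_div_assoc]

lemma integrable_pow_mul_gaussPdf (n : ℕ) : Integrable fun y : ℝ => y ^ n * gaussPdf y := by
  simp only [pow_mul_gaussPdf]
  exact (integrable_pow_mul_gauss n).div_const _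

lemma integral_sq_mul_gaussPdf : ∫ y : ℝ, y ^ 2 * gaussPdf y = 1 := by
  simp only [pow_mul_gaussPdf]
  have h := integral_pow_add_two_mul_gauss 0
  simp only [pow_zero, one_mul, integral_gauss, zero_add, Nat.cast_zero] at h
  rw [integral_div, h]
  exact div_self (by positivity)

lemma integral_pow_four_mul_gaussPdf : ∫ y : ℝ, y ^ 4 * gaussPdf y = 3 := by
  have h := integral_pow_add_two_mul_gauss 2
  have h2 := integral_sq_mul_gaussPdf
  simp only [pow_mul_gaussPdf, integral_div] at h2 ⊢
  norm_num at h
  rw [h, mul_div_assoc, h2]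
  norm_num

lemma gaussPdf_nonneg (y : ℝ) : 0 ≤ gaussPdf y := by
  unfold gaussPdf
  positivity

section Lipschitz

variable {c : ℝ} {f : ℝ → ℝ}

lemma continuous_of_abs_sub_le (hf : ∀ x y, |f x - f y| ≤ c * |x - y|) : Continuous f := by
  have : LipschitzWith (Real.toNNReal c) f := LipschitzWith.of_dist_le' hf
  exact this.continuous

lemma nonneg_of_abs_sub_le (hf : ∀ x y, |f x - f y| ≤ c * |x - y|) : 0 ≤ c := by
  have h := (abs_nonneg _).trans (hf 1 0)
  simpa using h

lemma integrable_sq_mul_mul_gauss (hf : ∀ x y, |f x - f y| ≤ c * |x - y|) :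
    Integrable fun y : ℝ => y ^ 2 * f y * Real.exp (-y ^ 2 / 2) := by
  have hc := nonneg_of_abs_sub_le hf
  have hcont := continuous_of_abs_sub_le hf
  refine ((((integrable_pow_mul_gauss 2).const_mul (|f 0| + c)).add
    ((integrable_pow_mul_gauss 4).const_mul c))).mono' (by fun_prop)
    (Filter.Eventually.of_forall fun y => ?_)
  have h1 := abs_add_le (f y - f 0) (f 0)
  have h2 := hf y 0
  simp only [sub_add_cancel, sub_zero] at h1 h2
  have h3 : |y| ≤ 1 + y ^ 2 := by nlinarith [sq_abs y, sq_nonneg (|y| - 1)]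
  have h4 : |f y| ≤ |f 0| + c * (1 + y ^ 2) := by
    nlinarith [mul_le_mul_of_nonneg_left h3 hc]
  rw [Real.norm_eq_abs, abs_mul, abs_mul, Real.abs_exp, abs_of_nonneg (sq_nonneg y)]
  have h5 := mul_le_mul_of_nonneg_left h4
    (mul_nonneg (sq_nonneg y) (Real.exp_pos (-y ^ 2 / 2)).le)
  simp only [Pi.add_apply]
  nlinarith

lemma abs_le_of_mean_eq_zero (hf : ∀ x y, |f x - f y| ≤ c * |x - y|)
    (h0 : ∫ y, f y * (y ^ 2 * gaussPdf y) = 0) (x : ℝ) : |f x| ≤ c * (|x| + 2) := by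
  have hc := nonneg_of_abs_sub_le hf
  have hif : Integrable fun y => f y * (y ^ 2 * gaussPdf y) := by
    refine ((integrable_sq_mul_mul_gauss hf).div_const (Real.sqrt (2 * Real.pi))).congr
      (Filter.Eventually.of_forall fun y => ?_)
    simp only [gaussPdf]
    ring
  have hi2 := integrable_pow_mul_gaussPdf 2
  have hi4 := integrable_pow_mul_gaussPdf 4
  have h1 : f x = ∫ y, (f x * (y ^ 2 * gaussPdf y) - f y * (y ^ 2 * gaussPdf y)) := by
    rw [integral_sub (hi2.const_mul _) hif, integral_const_mul, integral_sq_mul_gaussPdf, h0]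
    ring
  have h2 : ∫ y, (c * (|x| + 1 / 2) * (y ^ 2 * gaussPdf y) + c / 2 * (y ^ 4 * gaussPdf y))
      = c * (|x| + 2) := by
    rw [integral_add (hi2.const_mul _) (hi4.const_mul _), integral_const_mul,
      integral_const_mul, integral_sq_mul_gaussPdf, integral_pow_four_mul_gaussPdf]
    ring
  rw [h1, ← h2, ← Real.norm_eq_abs]
  refine norm_integral_le_of_norm_le ((hi2.const_mul _).add (hi4.const_mul _))
    (Filter.Eventually.of_forall fun y => ?_)
  have hp := mul_nonneg (sq_nonneg y) (gaussPdf_nonneg y)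
  rw [← sub_mul, Real.norm_eq_abs, abs_mul, abs_of_nonneg hp]
  have h3 : |x - y| ≤ |x| + 1 / 2 + y ^ 2 / 2 := by
    have := abs_sub x y
    nlinarith [sq_abs y, sq_nonneg (|y| - 1)]
  have h4 := (hf x y).trans (mul_le_mul_of_nonneg_left h3 hc)
  have h5 := mul_le_mul_of_nonneg_right h4 hp
  nlinarith

lemma abs_mul_abs_tail_le_of_neg (hf : ∀ x y, |f x - f y| ≤ c * |x - y|) {x : ℝ} (hx : x < 0) :
    |x| * |(∫ y in Set.Iic x, y ^ 2 * f y * Real.exp (-y ^ 2 / 2))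
      + x * f x * Real.exp (-x ^ 2 / 2)| ≤ (2 * c * |x| + |f x|) * Real.exp (-x ^ 2 / 2) := by
  have hc := nonneg_of_abs_sub_le hf
  have hi0 : Integrable fun y : ℝ => Real.exp (-y ^ 2 / 2) := by
    simpa using integrable_pow_mul_gauss 0
  have hi1 : Integrable fun y : ℝ => y * Real.exp (-y ^ 2 / 2) := by
    simpa using integrable_pow_mul_gauss 1
  have hi2 := integrable_pow_mul_gauss 2
  have hi3 := integrable_pow_mul_gauss 3
  have hif := integrable_sq_mul_mul_gauss hf
  have hd2 : ∀ y ∈ Set.Iic x, HasDerivAt (fun y : ℝ => -(y * Real.exp (-y ^ 2 / 2)))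
      (y ^ 2 * Real.exp (-y ^ 2 / 2) - Real.exp (-y ^ 2 / 2)) y := by
    intro y _
    refine ((hasDerivAt_id' y).mul (hasDerivAt_gauss y)).neg.congr_deriv ?_
    ring
  have hI2 := integral_Iic_of_hasDerivAt_of_tendsto' hd2 (hi2.sub hi0).integrableOn
    (tendsto_zero_of_hasDerivAt_of_integrableOn_Iic hd2 (hi2.sub hi0).integrableOn
      hi1.neg.integrableOn)
  have hrep : (∫ y in Set.Iic x, y ^ 2 * f y * Real.exp (-y ^ 2 / 2))
      + x * f x * Real.exp (-x ^ 2 / 2)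
      = ∫ y in Set.Iic x, (y ^ 2 * f y * Real.exp (-y ^ 2 / 2)
        - f x * (y ^ 2 * Real.exp (-y ^ 2 / 2) - Real.exp (-y ^ 2 / 2))) := by
    have hi : Integrable fun y : ℝ =>
        f x * (y ^ 2 * Real.exp (-y ^ 2 / 2) - Real.exp (-y ^ 2 / 2)) :=
      (hi2.sub hi0).const_mul _
    rw [integral_sub hif.integrableOn hi.integrableOn, integral_const_mul, hI2]
    ring
  have hd3 : ∀ y ∈ Set.Iic x, HasDerivAt
      (fun y : ℝ => (c * (-x) * ((y ^ 2 + 2) - x * y) + |f x|) * Real.exp (-y ^ 2 / 2))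
      ((c * (-x) * (-y ^ 3 + x * (y ^ 2 - 1)) + |f x| * (-y)) * Real.exp (-y ^ 2 / 2)) y := by
    intro y _
    have h1 : HasDerivAt (fun y : ℝ => c * (-x) * ((y ^ 2 + 2) - x * y) + |f x|)
        (c * (-x) * (2 * y - x)) y := by
      refine (((((hasDerivAt_pow 2 y).add_const 2).sub
        ((hasDerivAt_id' y).const_mul x)).const_mul (c * (-x))).add_const |f x|).congr_deriv ?_
      norm_num
    refine (h1.mul (hasDerivAt_gauss y)).congr_deriv ?_
    ring
  have hm : Integrable fun y : ℝ =>
      (c * (-x) * (-y ^ 3 + x * (y ^ 2 - 1)) + |f x| * (-y)) * Real.exp (-y ^ 2 / 2) := by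
    refine ((((hi3.const_mul (c * x)).add (hi2.const_mul (-c * x ^ 2))).add
      (hi0.const_mul (c * x ^ 2))).add (hi1.const_mul (-|f x|))).congr
      (Filter.Eventually.of_forall fun y => ?_)
    simp only [Pi.add_apply]
    ring
  have hM : Integrable fun y : ℝ =>
      (c * (-x) * ((y ^ 2 + 2) - x * y) + |f x|) * Real.exp (-y ^ 2 / 2) := by
    refine (((hi2.const_mul (-c * x)).add (hi1.const_mul (c * x ^ 2))).add
      (hi0.const_mul (-2 * c * x + |f x|))).congr
      (Filter.Eventually.of_forall fun y => ?_)
    simp only [Pi.add_apply]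
    ring
  have hI3 := integral_Iic_of_hasDerivAt_of_tendsto' hd3 hm.integrableOn
    (tendsto_zero_of_hasDerivAt_of_integrableOn_Iic hd3 hm.integrableOn hM.integrableOn)
  have hval : (2 * c * |x| + |f x|) * Real.exp (-x ^ 2 / 2) =
      ∫ y in Set.Iic x,
        (c * (-x) * (-y ^ 3 + x * (y ^ 2 - 1)) + |f x| * (-y)) * Real.exp (-y ^ 2 / 2) := by
    rw [hI3, abs_of_neg hx]
    ring
  rw [hrep, hval, ← abs_mul, ← integral_const_mul, ← Real.norm_eq_abs]
  refine norm_integral_le_of_norm_le hm.integrableOn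
    ((ae_restrict_iff' measurableSet_Iic).2 (Filter.Eventually.of_forall fun y hy => ?_))
  have hyx : y ≤ x := hy
  have hfac : x * (y ^ 2 * f y * Real.exp (-y ^ 2 / 2)
      - f x * (y ^ 2 * Real.exp (-y ^ 2 / 2) - Real.exp (-y ^ 2 / 2)))
      = x * (y ^ 2 * (f y - f x) + f x) * Real.exp (-y ^ 2 / 2) := by ring
  rw [hfac, Real.norm_eq_abs, abs_mul, Real.abs_exp, abs_mul, abs_of_neg hx]
  refine mul_le_mul_of_nonneg_right ?_ (Real.exp_pos _).le
  have h1 := abs_add_le (y ^ 2 * (f y - f x)) (f x)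
  rw [abs_mul, abs_of_nonneg (sq_nonneg y)] at h1
  have h2 := hf y x
  rw [abs_of_nonpos (by linarith : y - x ≤ 0)] at h2
  have h3 := mul_le_mul_of_nonneg_left h2 (sq_nonneg y)
  have h4 : -x * |y ^ 2 * (f y - f x) + f x| ≤ -x * (y ^ 2 * (c * -(y - x)) + |f x|) :=
    mul_le_mul_of_nonneg_left (by linarith) (by linarith)
  have h5 : -x * |f x| ≤ |f x| * (-y) := by nlinarith [abs_nonneg (f x)]
  have h6 : 0 ≤ c * x ^ 2 := by positivity
  nlinarith

lemma abs_mul_abs_tail_le (hf : ∀ x y, |f x - f y| ≤ c * |x - y|)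
    (h0 : ∫ y, y ^ 2 * f y * Real.exp (-y ^ 2 / 2) = 0) {x : ℝ} (hx : x ≠ 0) :
    |x| * |(∫ y in Set.Iic x, y ^ 2 * f y * Real.exp (-y ^ 2 / 2))
      + x * f x * Real.exp (-x ^ 2 / 2)| ≤ (2 * c * |x| + |f x|) * Real.exp (-x ^ 2 / 2) := by
  rcases lt_or_gt_of_ne hx with hx | hx
  · exact abs_mul_abs_tail_le_of_neg hf hx
  have hneg : ∀ x y, |f (-x) - f (-y)| ≤ c * |x - y| := by
    intro x y
    have := hf (-x) (-y)
    rwa [show -x - -y = -(x - y) by ring, abs_neg] at this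
  have h := abs_mul_abs_tail_le_of_neg (f := fun y => f (-y)) hneg (neg_lt_zero.2 hx)
  have hcomp := integral_comp_neg_Iic (-x) (fun y => y ^ 2 * f y * Real.exp (-y ^ 2 / 2))
  simp only [neg_neg, neg_sq] at hcomp h
  have hsplit := intervalIntegral.integral_Iic_add_Ioi (b := x)
    (integrable_sq_mul_mul_gauss hf).integrableOn (integrable_sq_mul_mul_gauss hf).integrableOn
  rw [h0] at hsplit
  rw [hcomp, abs_neg] at h
  rw [← abs_neg (_ + _)]
  convert h using 3
  linarith

end Lipschitz

lemma hasDerivAt_integral_Iic {u : ℝ → ℝ} (hu : Continuous u) (hi : Integrable u) (x : ℝ) :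
    HasDerivAt (fun x => ∫ y in Set.Iic x, u y) (u x) x := by
  have h1 : (fun x => ∫ y in Set.Iic x, u y)
      = fun x => (∫ y in Set.Iic 0, u y) + ∫ y in (0 : ℝ)..x, u y := by
    ext z
    rw [← intervalIntegral.integral_Iic_sub_Iic hi.integrableOn hi.integrableOn]
    ring
  rw [h1]
  exact (intervalIntegral.integral_hasDerivAt_right hi.intervalIntegrable
    (hu.stronglyMeasurableAtFilter _ _) hu.continuousAt).const_add _

lemma abs_sub_le_of_eq_integral {c : ℝ} {h h' : ℝ → ℝ} (hmeas : Measurable h')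
    (hbd : ∀ t, |h' t| ≤ c) (hac : ∀ y, h y = h 0 + ∫ t in (0 : ℝ)..y, h' t) (x y : ℝ) :
    |h x - h y| ≤ c * |x - y| := by
  have hint : ∀ a b : ℝ, IntervalIntegrable h' volume a b := fun a b =>
    (intervalIntegrable_const (c := c)).mono_fun' hmeas.aestronglyMeasurable
      (Filter.Eventually.of_forall hbd)
  have h1 : h x - h y = ∫ t in y..x, h' t := by
    rw [hac x, hac y, ← intervalIntegral.integral_interval_sub_left (hint 0 x) (hint 0 y)]
    ring
  rw [h1]
  exact intervalIntegral.norm_integral_le_of_norm_le_const (f := h') fun t _ => hbd t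

end GaussianSteinBound

/-- With `h` absolutely continuous, `|h'| ≤ c`, `μh = E[h(X)]` for `X` with
density `x² φ(x)`, `G(x) = e^{x²/2} ∫_{-∞}^x y² (h y - μh) e^{-y²/2} dy`,
`g(x) = G(x)/(x²+2)` and `χ(x) = g'(x)/x` for `x ≠ 0`, one has `|χ x| ≤ 6c` and
`|χ' x| ≤ 7c` for every `x ≠ 0`. -/
theorem stmt18 (c : ℝ) (h h' : ℝ → ℝ) (hmeas : Measurable h') (hbd : ∀ t, |h' t| ≤ c)
    (hac : ∀ y, h y = h 0 + ∫ t in (0:ℝ)..y, h' t)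
    (μh : ℝ) (hμh : μh = ∫ y, h y * (y ^ 2 * gaussPdf y))
    (G : ℝ → ℝ)
    (hG : ∀ x, G x = Real.exp (x ^ 2 / 2) *
      ∫ y in Set.Iic x, y ^ 2 * (h y - μh) * Real.exp (-y ^ 2 / 2))
    (g : ℝ → ℝ) (hg : ∀ x, g x = G x / (x ^ 2 + 2))
    (χ : ℝ → ℝ) (hχ : ∀ x, x ≠ 0 → χ x = deriv g x / x) :
    ∀ x : ℝ, x ≠ 0 → |χ x| ≤ 6 * c ∧ |deriv χ x| ≤ 7 * c := by
  have hhL := GaussianSteinBound.abs_sub_le_of_eq_integral hmeas hbd hac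
  obtain ⟨f, hfdef⟩ : ∃ f : ℝ → ℝ, ∀ y, f y = h y - μh := ⟨_, fun _ => rfl⟩
  have hf : ∀ x y, |f x - f y| ≤ c * |x - y| := by
    intro x y
    simpa [hfdef] using hhL x y
  have hc := GaussianSteinBound.nonneg_of_abs_sub_le hf
  have hfc := GaussianSteinBound.continuous_of_abs_sub_le hf
  have hif := GaussianSteinBound.integrable_sq_mul_mul_gauss hf
  have hsqrt : Real.sqrt (2 * Real.pi) ≠ 0 := by positivity
  have hmean : ∫ y, f y * (y ^ 2 * gaussPdf y) = 0 := by
    have hih : Integrable fun y => h y * (y ^ 2 * gaussPdf y) := by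
      refine ((GaussianSteinBound.integrable_sq_mul_mul_gauss hhL).div_const
        (Real.sqrt (2 * Real.pi))).congr (Filter.Eventually.of_forall fun y => ?_)
      simp only [gaussPdf]
      ring
    simp only [hfdef, sub_mul]
    rw [integral_sub hih ((GaussianSteinBound.integrable_pow_mul_gaussPdf 2).const_mul μh),
      integral_const_mul, GaussianSteinBound.integral_sq_mul_gaussPdf, ← hμh]
    ring
  have hmean' : ∫ y, y ^ 2 * f y * Real.exp (-y ^ 2 / 2) = 0 := by
    have h1 : ∀ y, f y * (y ^ 2 * gaussPdf y)
        = y ^ 2 * f y * Real.exp (-y ^ 2 / 2) / Real.sqrt (2 * Real.pi) := by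
      intro y
      rw [gaussPdf]
      ring
    simp only [h1, integral_div] at hmean
    exact (div_eq_zero_iff.1 hmean).resolve_right hsqrt
  have hG' : ∀ x, HasDerivAt G (x * G x + x ^ 2 * f x) x := by
    intro x
    have hGf : G = fun x => Real.exp (x ^ 2 / 2) *
        ∫ y in Set.Iic x, y ^ 2 * f y * Real.exp (-y ^ 2 / 2) := by
      ext z
      simp only [hG, hfdef]
    have hsq : HasDerivAt (fun x : ℝ => x ^ 2 / 2) x x := by
      refine ((hasDerivAt_pow 2 x).div_const 2).congr_deriv ?_
      norm_num
    have hE := hsq.exp.mul (GaussianSteinBound.hasDerivAt_integral_Iic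
      (u := fun y => y ^ 2 * f y * Real.exp (-y ^ 2 / 2)) (by fun_prop) hif x)
    have hee : Real.exp (x ^ 2 / 2) * Real.exp (-x ^ 2 / 2) = 1 := by
      rw [← Real.exp_add]
      simp [neg_div]
    rw [hGf]
    refine hE.congr_deriv ?_
    linear_combination (x ^ 2 * f x) * hee
  have hden : ∀ x : ℝ, HasDerivAt (fun x : ℝ => x ^ 2 + 2) (2 * x) x := by
    intro x
    refine ((hasDerivAt_pow 2 x).add_const 2).congr_deriv ?_
    norm_num
  have hχf : ∀ x, x ≠ 0 → χ x = x ^ 2 * G x / (x ^ 2 + 2) ^ 2 + x * f x / (x ^ 2 + 2) := by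
    intro x hx
    have hs : x ^ 2 + 2 ≠ 0 := by positivity
    have hgd := ((hG' x).div (hden x) hs).deriv
    rw [hχ x hx, show g = G / fun x => x ^ 2 + 2 from funext hg, hgd]
    field_simp
    ring
  intro x hx
  have hs0 : 0 < x ^ 2 + 2 := by positivity
  have hs : x ^ 2 + 2 ≠ 0 := hs0.ne'
  obtain ⟨R, hR⟩ : ∃ R, R = x * (G x + x * f x) := ⟨_, rfl⟩
  have hfx := GaussianSteinBound.abs_le_of_mean_eq_zero hf hmean x
  have hRx : |R| ≤ c * (3 * |x| + 2) := by
    have ht := GaussianSteinBound.abs_mul_abs_tail_le hf hmean' hx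
    have hee : Real.exp (x ^ 2 / 2) * Real.exp (-x ^ 2 / 2) = 1 := by
      rw [← Real.exp_add]
      simp [neg_div]
    have h1 : R = Real.exp (x ^ 2 / 2) *
        (x * ((∫ y in Set.Iic x, y ^ 2 * f y * Real.exp (-y ^ 2 / 2))
          + x * f x * Real.exp (-x ^ 2 / 2))) := by
      rw [hR, hG]
      simp only [← hfdef]
      linear_combination (-(x ^ 2 * f x)) * hee
    rw [h1, abs_mul, Real.abs_exp, abs_mul]
    calc _ ≤ Real.exp (x ^ 2 / 2) * ((2 * c * |x| + |f x|) * Real.exp (-x ^ 2 / 2)) :=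
          mul_le_mul_of_nonneg_left ht (Real.exp_pos _).le
      _ = 2 * c * |x| + |f x| := by linear_combination (2 * c * |x| + |f x|) * hee
      _ ≤ c * (3 * |x| + 2) := by linarith
  have hxx : |x| ^ 2 = x ^ 2 := sq_abs x
  have hx0 := abs_nonneg x
  constructor
  · have h1 : χ x = x * (2 * f x + R) / (x ^ 2 + 2) ^ 2 := by
      rw [hχf x hx, hR]
      field_simp
      ring
    rw [h1, abs_div, abs_mul, abs_of_pos (pow_pos hs0 2), div_le_iff₀ (by positivity)]
    have h2 : |2 * f x + R| ≤ c * (5 * |x| + 6) := by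
      have h3 := abs_add_le (2 * f x) R
      rw [abs_mul, abs_two] at h3
      linarith
    calc |x| * |2 * f x + R| ≤ |x| * (c * (5 * |x| + 6)) := by gcongr
      _ = c * (5 * |x| ^ 2 + 6 * |x|) := by ring
      _ ≤ c * (6 * (x ^ 2 + 2) ^ 2) := by
          refine mul_le_mul_of_nonneg_left ?_ hc
          rw [← hxx]
          nlinarith [sq_nonneg (|x| - 1), sq_nonneg (|x| ^ 2)]
      _ = 6 * c * (x ^ 2 + 2) ^ 2 := by ring
  by_cases hdiff : DifferentiableAt ℝ χ x
  swap
  · rw [deriv_zero_of_not_differentiableAt hdiff, abs_zero]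
    positivity
  have hne : ∀ᶠ y in nhds x, y ≠ 0 := isOpen_ne.mem_nhds hx
  have hfd : DifferentiableAt ℝ f x := by
    have h1 : DifferentiableAt ℝ
        (fun y => (χ y - y ^ 2 * G y / (y ^ 2 + 2) ^ 2) * (y ^ 2 + 2) / y) x := by
      have hGd := (hG' x).differentiableAt
      have hs2 : (x ^ 2 + 2) ^ 2 ≠ 0 := pow_ne_zero 2 hs
      fun_prop (disch := assumption)
    refine h1.congr_of_eventuallyEq ?_
    filter_upwards [hne] with y hy
    have hsy : y ^ 2 + 2 ≠ 0 := by positivity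
    rw [hχf y hy]
    field_simp
    ring
  obtain ⟨d, hd⟩ : ∃ d, d = deriv f x := ⟨_, rfl⟩
  have hdc : |d| ≤ c := by
    have hL : LipschitzWith c.toNNReal f := LipschitzWith.of_dist_le' hf
    have := norm_deriv_le_of_lipschitz (x₀ := x) hL
    rwa [Real.coe_toNNReal _ hc, ← hd] at this
  have hfd' : HasDerivAt f d x := hd ▸ hfd.hasDerivAt
  have hder : deriv χ x
      = (R * (x ^ 4 + 4) + f x * (x ^ 2 - 2) ^ 2) / (x ^ 2 + 2) ^ 3 + x * d / (x ^ 2 + 2) := by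
    have h1 : HasDerivAt (fun y => y ^ 2 * G y / (y ^ 2 + 2) ^ 2 + y * f y / (y ^ 2 + 2)) _ x :=
      (((hasDerivAt_pow 2 x).mul (hG' x)).div ((hden x).pow 2) (pow_ne_zero 2 hs)).add
        (((hasDerivAt_id' x).mul hfd').div (hden x) hs)
    have h2 : χ =ᶠ[nhds x]
        fun y => y ^ 2 * G y / (y ^ 2 + 2) ^ 2 + y * f y / (y ^ 2 + 2) := by
      filter_upwards [hne] with y hy using hχf y hy
    rw [h2.deriv_eq, h1.deriv, hR]
    simp only [Pi.mul_apply, Pi.pow_apply]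
    field_simp
    push_cast
    ring
  have e1 : |R * (x ^ 4 + 4) + f x * (x ^ 2 - 2) ^ 2|
      ≤ (c * (4 * |x| + 4)) * (x ^ 2 + 2) ^ 2 := by
    have h1 := abs_add_le (R * (x ^ 4 + 4)) (f x * (x ^ 2 - 2) ^ 2)
    rw [abs_mul R, abs_mul (f x), abs_of_pos (by positivity : 0 < x ^ 4 + 4),
      abs_of_nonneg (by positivity : 0 ≤ (x ^ 2 - 2) ^ 2)] at h1
    have h2 : |R| * (x ^ 4 + 4) ≤ (c * (3 * |x| + 2)) * (x ^ 2 + 2) ^ 2 :=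
      mul_le_mul hRx (by nlinarith [sq_nonneg x]) (by positivity) (by positivity)
    have h3 : |f x| * (x ^ 2 - 2) ^ 2 ≤ (c * (|x| + 2)) * (x ^ 2 + 2) ^ 2 :=
      mul_le_mul hfx (by nlinarith [sq_nonneg x]) (by positivity) (by positivity)
    linarith
  have e2 : |x * d| ≤ c * |x| := by
    rw [abs_mul, mul_comm]
    gcongr
  rw [hder]
  calc _ ≤ |(R * (x ^ 4 + 4) + f x * (x ^ 2 - 2) ^ 2) / (x ^ 2 + 2) ^ 3|
        + |x * d / (x ^ 2 + 2)| := abs_add_le _ _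
    _ = |R * (x ^ 4 + 4) + f x * (x ^ 2 - 2) ^ 2| / (x ^ 2 + 2) ^ 3
        + |x * d| / (x ^ 2 + 2) := by
          rw [abs_div, abs_div, abs_of_pos hs0, abs_of_pos (pow_pos hs0 3)]
    _ ≤ (c * (4 * |x| + 4)) * (x ^ 2 + 2) ^ 2 / (x ^ 2 + 2) ^ 3
        + c * |x| / (x ^ 2 + 2) := by gcongr
    _ = c * ((5 * |x| + 4) / (x ^ 2 + 2)) := by
          field_simp
          ring
    _ ≤ c * 7 := by
          refine mul_le_mul_of_nonneg_left ?_ hc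
          rw [div_le_iff₀ hs0, ← hxx]
          nlinarith [sq_nonneg (|x| - 1)]
    _ = 7 * c := mul_comm _ _
end

section
/- There exists a constant C > 0 such that for every even integer N ≥ 4, if x_1 > x_2 > ... > x_N is the strictly decreasing zero-mean solution of the Maxwell recursion, then x_1 ≤ C √(log N). -/
open Finset

/-- If the cubes of `a > b` differ by `3 / S` with `S ≥ 1 / a`, then the loss of `x ^ 2 / 9` in the
step from `a` to `b ≥ 1` is at most the gain of `log S`. -/
lemma maxwell_step {a b S : ℝ} (hb : 1 ≤ b) (hab : b < a) (hS : a⁻¹ ≤ S)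
    (h : b ^ 3 = a ^ 3 - 3 / S) :
    a ^ 2 - b ^ 2 ≤ 9 * (Real.log (S + b⁻¹) - Real.log S) := by
  have ha : 0 < a := by linarith
  have hb0 : 0 < b := by linarith
  have hSpos : 0 < S := lt_of_lt_of_le (inv_pos.2 ha) hS
  have haS : 1 ≤ a * S := by
    have := mul_le_mul_of_nonneg_left hS ha.le
    rwa [mul_inv_cancel₀ ha.ne'] at this
  have hcube : (a ^ 3 - b ^ 3) * S = 3 := by
    rw [h]; field_simp; ring
  have hsq : a * (a ^ 2 - b ^ 2) ≤ a ^ 3 - b ^ 3 := by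
    nlinarith [mul_nonneg (sq_nonneg b) (sub_nonneg.2 hab.le)]
  have hsqS : (a ^ 2 - b ^ 2) * (a * S) ≤ 3 := by
    nlinarith [mul_le_mul_of_nonneg_right hsq hSpos.le]
  have hdiff : 0 ≤ a ^ 2 - b ^ 2 := by nlinarith
  have hle : a ^ 2 - b ^ 2 ≤ 3 := by nlinarith
  have ha2 : a ≤ 2 * b := by nlinarith
  have hbS : 1 ≤ 2 * (b * S) := by nlinarith
  have hlog : Real.log (S + b⁻¹) - Real.log S = -Real.log (b * S / (b * S + 1)) := by
    rw [← Real.log_div (by positivity) hSpos.ne', ← Real.log_inv]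
    congr 1
    field_simp
  have hlog_le : Real.log (b * S / (b * S + 1)) ≤ b * S / (b * S + 1) - 1 :=
    Real.log_le_sub_one_of_pos (by positivity)
  have hfrac : b * S / (b * S + 1) - 1 = -(1 / (b * S + 1)) := by
    field_simp; ring
  have hmain : a ^ 2 - b ^ 2 ≤ 9 * (1 / (b * S + 1)) := by
    rw [mul_one_div, le_div_iff₀ (by positivity)]
    have hbaS : b * S ≤ a * S := mul_le_mul_of_nonneg_right hab.le hSpos.le
    nlinarith [mul_le_mul_of_nonneg_left hbaS hdiff, mul_le_mul_of_nonneg_left hbS hdiff]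
  linarith

/-- As long as the terms of a strictly decreasing solution stay above `1`, the quantity
`x n ^ 2 / 9 + log (S n)` is at least its initial value. -/
lemma maxwell_log_growth {x : ℕ → ℝ} {m : ℕ}
    (hge : ∀ n ∈ Finset.Icc 1 m, 1 ≤ x n)
    (hrec : ∀ n ∈ Finset.Ico 1 m,
      (x (n + 1)) ^ 3 = (x n) ^ 3 - 3 / (∑ i ∈ Finset.Icc 1 n, (x i)⁻¹))
    (hdec : ∀ n ∈ Finset.Ico 1 m, x (n + 1) < x n) (hm : 1 ≤ m) :
    x 1 ^ 2 - x m ^ 2 ≤ 9 * (Real.log (∑ i ∈ Finset.Icc 1 m, (x i)⁻¹) + Real.log (x 1)) := by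
  induction m, hm using Nat.le_induction with
  | base => simp
  | succ k hk ih =>
    have ihk := ih (fun n hn => hge n (by simp at hn ⊢; omega))
      (fun n hn => hrec n (by simp at hn ⊢; omega)) (fun n hn => hdec n (by simp at hn ⊢; omega))
    have hkmem : k ∈ Finset.Ico 1 (k + 1) := by simp; omega
    have hS : (x k)⁻¹ ≤ ∑ i ∈ Finset.Icc 1 k, (x i)⁻¹ :=
      Finset.single_le_sum (f := fun i => (x i)⁻¹)
        (fun i hi => inv_nonneg.2 (zero_le_one.trans (hge i (by simp at hi ⊢; omega))))
        (by simp; omega)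
    have := maxwell_step (hge (k + 1) (by simp)) (hdec k hkmem) hS (hrec k hkmem)
    rw [Finset.sum_Icc_succ_top (by omega)]
    linarith

/-- There is a constant `C > 0` such that for every even `N ≥ 4`,
the strictly decreasing zero-mean solution of the Maxwell recursion satisfies
`x 1 ≤ C √(log N)`. -/
theorem stmt19 :
    ∃ C : ℝ, 0 < C ∧ ∀ N : ℕ, Even N → 4 ≤ N → ∀ x : ℕ → ℝ,
      (∀ n ∈ Finset.Icc 1 N, x n ≠ 0) →
      (∀ n ∈ Finset.Icc 1 (N - 1),
        (∑ i ∈ Finset.Icc 1 n, (x i)⁻¹) ≠ 0 ∧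
        (x (n + 1)) ^ 3 = (x n) ^ 3 - 3 / (∑ i ∈ Finset.Icc 1 n, (x i)⁻¹)) →
      (∀ m ∈ Finset.Icc 1 N, ∀ n ∈ Finset.Icc 1 N, m < n → x n < x m) →
      (∑ n ∈ Finset.Icc 1 N, x n) = 0 →
      x 1 ≤ C * Real.sqrt (Real.log N) := by
  refine ⟨11, by norm_num, fun N _ hN x _ hrec hdec hsum => ?_⟩
  have hlogN : 1 ≤ Real.log N := by
    rw [Real.le_log_iff_exp_le (by positivity)]
    have : (4 : ℝ) ≤ N := by exact_mod_cast hN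
    linarith [Real.exp_one_lt_d9]
  have hsqrt : 1 ≤ Real.sqrt (Real.log N) := Real.one_le_sqrt.2 hlogN
  rcases lt_or_ge (x 1) 1 with h1 | h1
  · linarith
  obtain ⟨m, hm1, hmN, hxm, hxm'⟩ : ∃ m, 1 ≤ m ∧ m < N ∧ 1 ≤ x m ∧ x (m + 1) < 1 := by
    by_contra! hcon
    have hall : ∀ n, 1 ≤ n → n ≤ N → 1 ≤ x n := by
      intro n hn
      induction n, hn using Nat.le_induction with
      | base => exact fun _ => h1
      | succ k hk ih => exact fun hkN => hcon k hk (by omega) (ih (by omega))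
    have hpos : 0 < ∑ n ∈ Finset.Icc 1 N, x n :=
      Finset.sum_pos (fun n hn => by
        rw [Finset.mem_Icc] at hn
        linarith [hall n hn.1 hn.2]) ⟨1, by simp; omega⟩
    linarith
  have hge : ∀ n ∈ Finset.Icc 1 m, x m ≤ x n := by
    intro n hn
    rw [Finset.mem_Icc] at hn
    rcases hn.2.eq_or_lt with rfl | hlt
    · exact le_rfl
    · exact (hdec n (by simp; omega) m (by simp; omega) hlt).le
  have hgrowth := maxwell_log_growth (fun n hn => hxm.trans (hge n hn))
    (fun n hn => (hrec n (by simp at hn ⊢; omega)).2)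
    (fun n hn => hdec n (by simp at hn ⊢; omega) (n + 1) (by simp at hn ⊢; omega) (by omega)) hm1
  have hS : (x m)⁻¹ ≤ ∑ i ∈ Finset.Icc 1 m, (x i)⁻¹ :=
    Finset.single_le_sum (f := fun i => (x i)⁻¹)
      (fun i hi => inv_nonneg.2 (by linarith [hge i hi])) (by simp; omega)
  have hS_le : ∑ i ∈ Finset.Icc 1 m, (x i)⁻¹ ≤ N := by
    calc ∑ i ∈ Finset.Icc 1 m, (x i)⁻¹ ≤ ∑ i ∈ Finset.Icc 1 m, (1 : ℝ) :=
          Finset.sum_le_sum fun i hi => inv_le_one_of_one_le₀ (hxm.trans (hge i hi))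
      _ = m := by simp
      _ ≤ N := by exact_mod_cast hmN.le
  have hrecm := (hrec m (by simp; omega)).2
  set S := ∑ i ∈ Finset.Icc 1 m, (x i)⁻¹
  have hSpos : 0 < S := lt_of_lt_of_le (by positivity) hS
  have hlogS : Real.log S ≤ Real.log N := Real.log_le_log hSpos hS_le
  have hxm2 : x m ≤ 2 := by
    have hdiv : 3 / S ≤ 3 * x m := by
      rw [div_le_iff₀ hSpos]
      have := mul_le_mul_of_nonneg_left hS (by linarith : 0 ≤ x m)
      rw [mul_inv_cancel₀ (by linarith)] at this
      linarith
    have hcube : x (m + 1) ^ 3 < 1 := by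
      have := (Odd.strictMono_pow (n := 3) (by decide) : StrictMono fun y : ℝ => y ^ 3) hxm'
      simpa using this
    by_contra! hgt
    nlinarith [mul_pos (sub_pos.2 hgt) (sub_pos.2 hgt)]
  have hlogx : Real.log (x 1) ≤ x 1 - 1 := Real.log_le_sub_one_of_pos (by linarith)
  have hsq : x 1 ^ 2 ≤ 11 ^ 2 * Real.log N := by
    nlinarith [sq_nonneg (x 1 - 9)]
  calc x 1 ≤ Real.sqrt (11 ^ 2 * Real.log N) := Real.le_sqrt_of_sq_le hsq
    _ = 11 * Real.sqrt (Real.log N) := by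
      rw [Real.sqrt_mul (by norm_num), Real.sqrt_sq (by norm_num)]
end
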